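/- Let f(x) = wᵀx + b be a linear function on ℝⁿ, and let I₁ = Πᵢ [aᵢ, bᵢ] and I₂ = Πᵢ [cᵢ, dᵢ] be n-dimensional cubes with I₁ ⊆ I₂ (so cᵢ ≤ aᵢ ≤ bᵢ ≤ dᵢ for all i). Suppose x is a vertex of I₂ and min f(I₂) = f(x). Then min f(I₁) = f(Proj(I₁, x)), where Proj(I₁, x) is the coordinatewise projection of x onto I₁. -/

import Mathlib

/-- Theorem 2(1): if a linear function `f` attains its minimum over the cube
`I₂ = Πᵢ [cᵢ, dᵢ]` at a vertex `x` of `I₂`, then its minimum over a sub-cube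
`I₁ = Πᵢ [aᵢ, bᵢ] ⊆ I₂` is attained at the coordinatewise projection of `x` onto `I₁`. -/
theorem deepsearch_projection_min
    (n : ℕ) (w : Fin n → ℝ) (β : ℝ)
    (f : (Fin n → ℝ) → ℝ)
    (hf : ∀ y, f y = (∑ i, w i * y i) + β)
    (a b c d : Fin n → ℝ)
    (hca : ∀ i, c i ≤ a i) (hab : ∀ i, a i ≤ b i) (hbd : ∀ i, b i ≤ d i)
    (x : Fin n → ℝ)
    (hvert : ∀ i, x i = c i ∨ x i = d i)
    (hmin : IsLeast (f '' Set.univ.pi fun i => Set.Icc (c i) (d i)) (f x))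
    (p : Fin n → ℝ)
    (hp : ∀ i, (b i ≤ x i → p i = b i) ∧ (x i ≤ a i → p i = a i)) :
    IsLeast (f '' Set.univ.pi fun i => Set.Icc (a i) (b i)) (f p) := by
  have hpI : ∀ i, p i ∈ Set.Icc (a i) (b i) := fun i => by
    rcases hvert i with h | h
    · rw [(hp i).2 (h.le.trans (hca i))]
      exact ⟨le_rfl, hab i⟩
    · rw [(hp i).1 ((hbd i).trans h.ge)]
      exact ⟨hab i, le_rfl⟩
  refine ⟨⟨p, fun i _ => hpI i, rfl⟩, ?_⟩
  rintro _ ⟨y, hy, rfl⟩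
  -- The translate of `x` by `y - p` stays in the larger cube.
  have hz : ∀ i, x i + (y i - p i) ∈ Set.Icc (c i) (d i) := fun i => by
    obtain ⟨hay, hyb⟩ := hy i trivial
    have hc := hca i
    have hd := hbd i
    rcases hvert i with h | h
    · have hpa := (hp i).2 (h.le.trans hc)
      constructor <;> linarith
    · have hpb := (hp i).1 (hd.trans h.ge)
      constructor <;> linarith
  have hle := hmin.2 ⟨fun i => x i + (y i - p i), fun i _ => hz i, rfl⟩
  simp only [hf, mul_add, mul_sub, Finset.sum_add_distrib, Finset.sum_sub_distrib] at hle ⊢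
  linarith
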